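/- Let k ≥ 2 and define the homogeneous degree-(2k−2) polynomials over ℚ: e_S := ((2k−2)!/2) · Σ_{m=1}^{k−1} (b_{2m}/(2m)!) · (b_{2k−2m}/(2k−2m)!) · X^{2m−1} Y^{2k−2m−1}, and e_T := ((2k−2)!/2) · (b_{2k}/(2k)!) · ((X+Y)^{2k−1} − X^{2k−1})/Y (a polynomial). Let Q_S := X^{2k−2} − Y^{2k−2}. Then ⟨e_S, Q_S|_T − Q_S|_{T⁻¹}⟩ − 2·⟨e_T, Q_S + Q_S|_T⟩ = 3·b_{2k}/(2k). (Here Q_S|_T = (X+Y)^{2k−2} − Y^{2k−2} and Q_S|_{T⁻¹} = (X−Y)^{2k−2} − Y^{2k−2}.) Equivalently, the Petersson–Haberlund pairing of the rational Eisenstein cocycle e⁰_{2k} with the coboundary δ⁰Y^{2k−2} equals 3·b_{2k}/(2k). -/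

import Mathlib

open MvPolynomial

/-- The pairing `⟨ , ⟩` on `V_{2k−2}`, given on monomials by
`⟨X^a Y^{d−a}, X^b Y^{d−b}⟩ = (−1)^a (choose d a)⁻¹` if `a + b = d` and `0` otherwise. -/
noncomputable def pairV (d : ℕ) (P Q : MvPolynomial (Fin 2) ℚ) : ℚ :=
  ∑ a ∈ Finset.range (d + 1),
    (-1 : ℚ) ^ a * ((d.choose a : ℚ))⁻¹ *
      coeff (Finsupp.single 0 a + Finsupp.single 1 (d - a)) P *
      coeff (Finsupp.single 0 (d - a) + Finsupp.single 1 a) Q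

/-- Euler's quadratic identity: if `B` is the exponential generating function of the Bernoulli
numbers, then `B ^ 2 = B - t * B - t * dB/dt`. -/
theorem bernoulliPowerSeries_sq :
    bernoulliPowerSeries ℚ ^ 2 = bernoulliPowerSeries ℚ -
      PowerSeries.X * bernoulliPowerSeries ℚ -
      PowerSeries.X * PowerSeries.derivative ℚ (bernoulliPowerSeries ℚ) := by
  have h := bernoulliPowerSeries_mul_exp_sub_one ℚ
  have h' := congrArg (PowerSeries.derivative ℚ) h
  simp only [Derivation.leibniz, map_sub, PowerSeries.derivative_exp, sub_zero,
    Derivation.map_one_eq_zero, smul_eq_mul, PowerSeries.derivative_X] at h'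
  linear_combination bernoulliPowerSeries ℚ * h' -
    (PowerSeries.derivative ℚ (bernoulliPowerSeries ℚ) + bernoulliPowerSeries ℚ) * h

theorem sum_range_bernoulli_mul_bernoulli (n : ℕ) :
    ∑ i ∈ Finset.range (n + 2),
      bernoulli i / (i.factorial : ℚ) *
        (bernoulli (n + 1 - i) / ((n + 1 - i).factorial : ℚ)) =
    -(n : ℚ) * (bernoulli (n + 1) / ((n + 1).factorial : ℚ)) -
      bernoulli n / (n.factorial : ℚ) := by
  have h := congrArg (PowerSeries.coeff (n + 1)) bernoulliPowerSeries_sq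
  rw [pow_two, PowerSeries.coeff_mul, Finset.Nat.sum_antidiagonal_eq_sum_range_succ_mk] at h
  simp only [map_sub, PowerSeries.coeff_succ_X_mul, PowerSeries.coeff_derivative,
    bernoulliPowerSeries, PowerSeries.coeff_mk, Algebra.algebraMap_self, RingHom.id_apply] at h
  rw [h]
  ring

theorem sum_range_two_mul_add_one_of_odd_eq_zero {M : Type*} [AddCommMonoid M] (f : ℕ → M)
    (k : ℕ) (hf : ∀ i < k, f (2 * i + 1) = 0) :
    ∑ i ∈ Finset.range (2 * k + 1), f i = ∑ m ∈ Finset.range (k + 1), f (2 * m) := by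
  induction k with
  | zero => simp
  | succ k ih =>
    rw [show 2 * (k + 1) + 1 = 2 * k + 1 + 1 + 1 by ring, Finset.sum_range_succ,
      Finset.sum_range_succ, hf k (by lia), ih fun i hi => hf i (by lia),
      Finset.sum_range_succ _ (k + 1), add_zero, show 2 * k + 1 + 1 = 2 * (k + 1) by ring]

theorem sum_Icc_bernoulli_mul_bernoulli (k : ℕ) (hk : 2 ≤ k) :
    ∑ m ∈ Finset.Icc 1 (k - 1), bernoulli (2 * m) / ((2 * m).factorial : ℚ) *
      (bernoulli (2 * k - 2 * m) / ((2 * k - 2 * m).factorial : ℚ)) =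
    -(2 * k + 1) * (bernoulli (2 * k) / ((2 * k).factorial : ℚ)) := by
  obtain ⟨j, rfl⟩ : ∃ j, k = j + 2 := ⟨k - 2, by lia⟩
  have h := sum_range_bernoulli_mul_bernoulli (2 * j + 3)
  rw [bernoulli_eq_zero_of_odd (n := 2 * j + 3) ⟨j + 1, by ring⟩ (by lia),
    show 2 * j + 3 + 2 = 2 * (j + 2) + 1 by ring, show 2 * j + 3 + 1 = 2 * (j + 2) by ring,
    sum_range_two_mul_add_one_of_odd_eq_zero, Finset.sum_range_succ,
    Finset.sum_range_succ'] at h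
  · rw [show j + 2 - 1 = j + 1 by lia, ← Finset.Ico_add_one_right_eq_Icc,
      Finset.sum_Ico_eq_sum_range]
    simp only [add_comm 1, Nat.add_sub_cancel]
    simp at h ⊢
    linear_combination h
  · intro i hi
    rcases Nat.eq_zero_or_pos i with rfl | hi'
    · rw [bernoulli_eq_zero_of_odd (n := 2 * (j + 2) - (2 * 0 + 1)) ⟨j + 1, by lia⟩ (by lia)]
      simp
    · rw [bernoulli_eq_zero_of_odd (n := 2 * i + 1) ⟨i, rfl⟩ (by lia)]
      simp

theorem coeff_C_mul_X_pow_mul_X_pow (c : ℚ) (i j a b : ℕ) :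
    coeff (Finsupp.single 0 a + Finsupp.single 1 b)
      (C c * X 0 ^ i * X 1 ^ j : MvPolynomial (Fin 2) ℚ) = if i = a ∧ j = b then c else 0 := by
  have h : (C c * X 0 ^ i * X 1 ^ j : MvPolynomial (Fin 2) ℚ) =
      monomial (Finsupp.single 0 i + Finsupp.single 1 j) c := by
    simp [X_pow_eq_monomial, C_mul_monomial, monomial_mul]
  rw [h, coeff_monomial]
  congr 1
  simp [Finsupp.ext_iff, Fin.forall_fin_two]

theorem coeff_X_zero_pow (i a b : ℕ) :
    coeff (Finsupp.single 0 a + Finsupp.single 1 b) (X 0 ^ i : MvPolynomial (Fin 2) ℚ) =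
      if i = a ∧ 0 = b then 1 else 0 := by
  simpa using coeff_C_mul_X_pow_mul_X_pow 1 i 0 a b

theorem coeff_X_one_pow (j a b : ℕ) :
    coeff (Finsupp.single 0 a + Finsupp.single 1 b) (X 1 ^ j : MvPolynomial (Fin 2) ℚ) =
      if 0 = a ∧ j = b then 1 else 0 := by
  simpa using coeff_C_mul_X_pow_mul_X_pow 1 0 j a b

theorem coeff_X_zero_add_C_mul_X_one_pow (c : ℚ) (a b : ℕ) :
    coeff (Finsupp.single 0 a + Finsupp.single 1 b)
      ((X 0 + C c * X 1 : MvPolynomial (Fin 2) ℚ) ^ (a + b)) = c ^ b * (a + b).choose a := by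
  have h : (X 0 + C c * X 1 : MvPolynomial (Fin 2) ℚ) ^ (a + b) =
      ∑ i ∈ Finset.range (a + b + 1),
        C (c ^ (a + b - i) * (a + b).choose i) * X 0 ^ i * X 1 ^ (a + b - i) := by
    rw [add_pow]
    refine Finset.sum_congr rfl fun i _ => ?_
    simp only [mul_pow, map_mul, map_pow, map_natCast]
    ring
  simp only [h, coeff_sum, coeff_C_mul_X_pow_mul_X_pow]
  rw [Finset.sum_eq_single a]
  · simp
  · intro i _ hi
    simp [hi]
  · intro ha
    simp at ha

theorem coeff_X_zero_add_X_one_pow (a b d : ℕ) (hd : a + b = d) :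
    coeff (Finsupp.single 0 a + Finsupp.single 1 b)
      ((X 0 + X 1 : MvPolynomial (Fin 2) ℚ) ^ d) = d.choose a := by
  subst hd
  simpa using coeff_X_zero_add_C_mul_X_one_pow 1 a b

theorem coeff_X_zero_sub_X_one_pow (a b d : ℕ) (hd : a + b = d) :
    coeff (Finsupp.single 0 a + Finsupp.single 1 b)
      ((X 0 - X 1 : MvPolynomial (Fin 2) ℚ) ^ d) = (-1) ^ b * d.choose a := by
  subst hd
  simpa [← sub_eq_add_neg] using coeff_X_zero_add_C_mul_X_one_pow (-1) a b

theorem pairV_C_mul (d : ℕ) (c : ℚ) (P Q : MvPolynomial (Fin 2) ℚ) :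
    pairV d (C c * P) Q = c * pairV d P Q := by
  simp only [pairV, coeff_C_mul, Finset.mul_sum]
  exact Finset.sum_congr rfl fun _ _ => by ring

theorem pairV_sum {ι : Type*} (d : ℕ) (s : Finset ι) (P : ι → MvPolynomial (Fin 2) ℚ)
    (Q : MvPolynomial (Fin 2) ℚ) : pairV d (∑ i ∈ s, P i) Q = ∑ i ∈ s, pairV d (P i) Q := by
  simp only [pairV, coeff_sum, Finset.mul_sum, Finset.sum_mul]
  exact Finset.sum_comm

theorem pairV_C_mul_X_pow_mul_X_pow (d a b : ℕ) (hd : a + b = d) (c : ℚ)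
    (Q : MvPolynomial (Fin 2) ℚ) :
    pairV d (C c * X 0 ^ a * X 1 ^ b) Q =
      (-1) ^ a * (d.choose a : ℚ)⁻¹ * c *
        coeff (Finsupp.single 0 b + Finsupp.single 1 a) Q := by
  subst hd
  simp only [pairV, coeff_C_mul_X_pow_mul_X_pow]
  rw [Finset.sum_eq_single a]
  · simp
  · intro i _ hi
    simp [hi.symm]
  · intro ha
    simp at ha

/-- The odd monomials pair with `(X + Y) ^ d - (X - Y) ^ d` to `-2`. -/
theorem pairV_odd_monomial (d a b : ℕ) (hd : a + b = d) (ha : Odd a) (c : ℚ) :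
    pairV d (C c * X 0 ^ a * X 1 ^ b) ((X 0 + X 1) ^ d - (X 0 - X 1) ^ d) = -2 * c := by
  have hba : b + a = d := by rw [add_comm, hd]
  have hne : (d.choose a : ℚ) ≠ 0 := by
    exact_mod_cast (Nat.choose_pos (by lia : a ≤ d)).ne'
  rw [pairV_C_mul_X_pow_mul_X_pow d a b hd, coeff_sub, coeff_X_zero_add_X_one_pow b a d hba,
    coeff_X_zero_sub_X_one_pow b a d hba, ha.neg_one_pow, Nat.choose_symm_of_eq_add hba.symm]
  field_simp
  ring

theorem coeff_of_X_one_mul_eq (d a b : ℕ) (hd : a + b = d) (c : ℚ) (P : MvPolynomial (Fin 2) ℚ)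
    (hP : X 1 * P = C c * ((X 0 + X 1) ^ (d + 1) - X 0 ^ (d + 1))) :
    coeff (Finsupp.single 0 a + Finsupp.single 1 b) P = c * (d + 1).choose a := by
  rw [← coeff_X_mul _ 1, hP, add_left_comm, ← Finsupp.single_add, coeff_C_mul, coeff_sub,
    coeff_X_zero_add_X_one_pow _ _ _ (by lia), coeff_X_zero_pow, if_neg (by lia), sub_zero]

theorem sum_range_neg_one_pow_mul_choose (d : ℕ) (hd : Even d) :
    ∑ a ∈ Finset.range (d + 1), (-1 : ℚ) ^ a * (d + 1).choose a = 1 := by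
  have h := Int.alternating_sum_range_choose_of_ne (Nat.succ_ne_zero d)
  rw [Finset.sum_range_succ] at h
  have h' : ∑ a ∈ Finset.range (d + 1), (-1 : ℤ) ^ a * (d + 1).choose a = 1 := by
    simpa [hd.add_one.neg_one_pow, add_neg_eq_zero] using h
  exact_mod_cast h'

theorem pairV_of_X_one_mul_eq (d : ℕ) (hd : Even d) (hd0 : d ≠ 0) (c : ℚ)
    (P : MvPolynomial (Fin 2) ℚ)
    (hP : X 1 * P = C c * ((X 0 + X 1) ^ (d + 1) - X 0 ^ (d + 1))) :
    pairV d P ((X 0 ^ d - X 1 ^ d) + ((X 0 + X 1) ^ d - X 1 ^ d)) = -2 * d * c := by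
  have h : ∀ a ∈ Finset.range (d + 1),
      (-1 : ℚ) ^ a * (d.choose a : ℚ)⁻¹ *
        coeff (Finsupp.single 0 a + Finsupp.single 1 (d - a)) P *
        coeff (Finsupp.single 0 (d - a) + Finsupp.single 1 a)
          ((X 0 ^ d - X 1 ^ d) + ((X 0 + X 1) ^ d - X 1 ^ d) : MvPolynomial (Fin 2) ℚ) =
      c * ((-1 : ℚ) ^ a * (d + 1).choose a) + (if a = 0 then c else 0) +
        if a = d then -2 * (d + 1) * c else 0 := by
    intro a ha
    have had : a ≤ d := by simpa [Nat.lt_succ_iff] using ha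
    have hne : (d.choose a : ℚ) ≠ 0 := by exact_mod_cast (Nat.choose_pos had).ne'
    rw [coeff_of_X_one_mul_eq d a (d - a) (by lia) c P hP, coeff_add, coeff_sub, coeff_sub,
      coeff_X_zero_pow, coeff_X_one_pow, coeff_X_zero_add_X_one_pow _ _ _ (by lia),
      Nat.choose_symm had]
    by_cases h0 : a = 0
    · subst h0
      simp [hd0, hd0.symm]
      ring
    · by_cases h1 : a = d
      · subst h1
        simp [hd0, hd0.symm, hd.neg_one_pow]
        ring
      · rw [if_neg (by lia), if_neg (by lia), if_neg h0, if_neg h1]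
        field_simp
        ring
  rw [pairV, Finset.sum_congr rfl h, Finset.sum_add_distrib, Finset.sum_add_distrib,
    ← Finset.mul_sum, sum_range_neg_one_pow_mul_choose d hd]
  simp
  ring

/-- For `k ≥ 2`, with
`e_S = ((2k−2)!/2)·Σ_{m=1}^{k−1} (b_{2m}/(2m)!)(b_{2k−2m}/(2k−2m)!) X^{2m−1}Y^{2k−2m−1}`,
`e_T` the polynomial with `Y·e_T = ((2k−2)!/2)·(b_{2k}/(2k)!)·((X+Y)^{2k−1} − X^{2k−1})`,
and `Q_S = X^{2k−2} − Y^{2k−2}`: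
`⟨e_S, Q_S|_T − Q_S|_{T⁻¹}⟩ − 2⟨e_T, Q_S + Q_S|_T⟩ = 3 b_{2k}/(2k)`, i.e. the
Petersson–Haberlund pairing of the rational Eisenstein cocycle with `δ⁰Y^{2k−2}` is
`3·b_{2k}/(2k)`. -/
theorem stmt_9 (k : ℕ) (hk : 2 ≤ k)
    (eT : MvPolynomial (Fin 2) ℚ)
    (heT : X 1 * eT =
      C ((((2 * k - 2).factorial : ℚ)) / 2 * (bernoulli (2 * k) / ((2 * k).factorial : ℚ))) *
        ((X 0 + X 1) ^ (2 * k - 1) - X 0 ^ (2 * k - 1))) :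
    pairV (2 * k - 2)
        (C (((2 * k - 2).factorial : ℚ) / 2) *
          ∑ m ∈ Finset.Icc 1 (k - 1),
            C (bernoulli (2 * m) / ((2 * m).factorial : ℚ) *
                (bernoulli (2 * k - 2 * m) / ((2 * k - 2 * m).factorial : ℚ))) *
              X 0 ^ (2 * m - 1) * X 1 ^ (2 * k - 2 * m - 1))
        ((X 0 + X 1) ^ (2 * k - 2) - (X 0 - X 1) ^ (2 * k - 2)) -
      2 * pairV (2 * k - 2) eT
        ((X 0 ^ (2 * k - 2) - X 1 ^ (2 * k - 2)) +
          ((X 0 + X 1) ^ (2 * k - 2) - X 1 ^ (2 * k - 2))) =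
    3 * bernoulli (2 * k) / (2 * k : ℚ) := by
  have hS : ∀ m ∈ Finset.Icc 1 (k - 1),
      pairV (2 * k - 2)
        (C (bernoulli (2 * m) / ((2 * m).factorial : ℚ) *
            (bernoulli (2 * k - 2 * m) / ((2 * k - 2 * m).factorial : ℚ))) *
          X 0 ^ (2 * m - 1) * X 1 ^ (2 * k - 2 * m - 1))
        ((X 0 + X 1) ^ (2 * k - 2) - (X 0 - X 1) ^ (2 * k - 2)) =
      -2 * (bernoulli (2 * m) / ((2 * m).factorial : ℚ) *
            (bernoulli (2 * k - 2 * m) / ((2 * k - 2 * m).factorial : ℚ))) := by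
    intro m hm
    rw [Finset.mem_Icc] at hm
    exact pairV_odd_monomial _ _ _ (by lia) ⟨m - 1, by lia⟩ _
  rw [show 2 * k - 1 = 2 * k - 2 + 1 by lia] at heT
  rw [pairV_C_mul, pairV_sum, Finset.sum_congr rfl hS, ← Finset.mul_sum,
    sum_Icc_bernoulli_mul_bernoulli k hk,
    pairV_of_X_one_mul_eq _ ⟨k - 1, by lia⟩ (by lia) _ _ heT]
  obtain ⟨j, rfl⟩ : ∃ j, k = j + 1 := ⟨k - 1, by lia⟩
  rw [show 2 * (j + 1) - 2 = 2 * j by lia, show 2 * (j + 1) = 2 * j + 1 + 1 by ring,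
    Nat.factorial_succ (2 * j + 1), Nat.factorial_succ (2 * j)]
  have hf : ((2 * j).factorial : ℚ) ≠ 0 := by exact_mod_cast (2 * j).factorial_ne_zero
  push_cast
  field_simp
  ring
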